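/- Suppose a Social Welfare Function w : P̄^N → P̄ admits a profile q ∈ P^N with w(q) = 𝐜 (as is guaranteed by Arrow's Impossibility Theorem when w satisfies Unanimity, IIA and Non-Dictatorship). Then for every individual i, in the Self-Reference System (w, Ω_i): q is a quasi-Gödel sentence with respect to the i-th indicator Υ_i (i.e., q ≤ ¬(Υ_i ∗ q)), and quasi-consistency and quasi-completeness of the pair (Υ_i, q) cannot hold simultaneously. Hence (w, Ω_i) is a quasi-Gödelian system with respect to Υ_i. -/

import Mathlib

/-- A weak order on `A`: a transitive and complete (total) binary relation. -/
structure WeakOrder (A : Type*) where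
  rel : A → A → Prop
  trans : ∀ a b c, rel a b → rel b c → rel a c
  total : ∀ a b, rel a b ∨ rel b a

namespace WeakOrder

/-- Strict preference: `a ≺ b` in `r`. -/
def strict {A : Type*} (r : WeakOrder A) (a b : A) : Prop := r.rel a b ∧ ¬ r.rel b a

/-- The reversed (converse) weak order. -/
def reverse {A : Type*} (r : WeakOrder A) : WeakOrder A :=
  ⟨fun a b => r.rel b a, fun a b c h1 h2 => r.trans c b a h2 h1, fun a b => r.total b a⟩

end WeakOrder

/-- The totally indifferent weak order `𝐢`. -/
def indiff (A : Type*) : WeakOrder A :=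
  ⟨fun _ _ => True, fun _ _ _ _ _ => trivial, fun _ _ => Or.inl trivial⟩

/-- The strictness ordering on weak orders: `r ≤ s` iff every strict
preference of `s` is a strict preference of `r`. -/
def strLE {A : Type*} (r s : WeakOrder A) : Prop :=
  ∀ a b, s.strict a b → r.strict a b

/-- `P̄ = P ∪ {𝐜}`, with `none` playing the role of the contradictory
preference cycle `𝐜` and `some r` the weak order `r`. -/
abbrev Pbar (A : Type*) := Option (WeakOrder A)

/-- The strictness ordering extended to `P̄`, with `𝐜 = none` as bottom. -/
def barLE {A : Type*} : Pbar A → Pbar A → Prop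
  | none, _ => True
  | some _, none => False
  | some r, some s => strLE r s

/-- `t` is a greatest lower bound of `r` and `s` in `(P̄, ≤)`. -/
def IsGLBbar {A : Type*} (r s t : Pbar A) : Prop :=
  barLE t r ∧ barLE t s ∧ ∀ u, barLE u r → barLE u s → barLE u t

/-- `t` is a least upper bound of `r` and `s` in `(P̄, ≤)`. -/
def IsLUBbar {A : Type*} (r s t : Pbar A) : Prop :=
  barLE r t ∧ barLE s t ∧ ∀ u, barLE r u → barLE s u → barLE t u

open Classical in
/-- `r ⊓ s`: the greatest lower bound of `r` and `s` in `(P̄, ≤)` (which always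
exists; `𝐜` as a default value otherwise). -/
noncomputable def pinf {A : Type*} (r s : Pbar A) : Pbar A :=
  if h : ∃ t, IsGLBbar r s t then h.choose else none

/-- `t` is a least upper bound of the weak orders `r` and `s` in the
strictness ordering on `P`. -/
def IsLUBw {A : Type*} (r s t : WeakOrder A) : Prop :=
  strLE r t ∧ strLE s t ∧ ∀ u, strLE r u → strLE s u → strLE t u

/-- `t` is a greatest lower bound of the weak orders `r` and `s` in the
strictness ordering on `P`. -/
def IsGLBw {A : Type*} (r s t : WeakOrder A) : Prop :=
  strLE t r ∧ strLE t s ∧ ∀ u, strLE u r → strLE u s → strLE u t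

open Classical in
/-- `r ⊔ s`: the least upper bound of two weak orders in the strictness
ordering (which always exists; default value otherwise). -/
noncomputable def wsup {A : Type*} (r s : WeakOrder A) : WeakOrder A :=
  if h : ∃ t, IsLUBw r s t then h.choose else indiff A

/-- The join `+ : P̄ × P̄ → P̄`: `r + s = r ⊔ s` when both are weak orders,
and `𝐢` otherwise. -/
noncomputable def pjoin {A : Type*} : Pbar A → Pbar A → Pbar A
  | some r, some s => some (wsup r s)
  | _, _ => some (indiff A)

open Classical in
/-- Negation on `P̄`: `¬𝐜 = 𝐢`, `¬𝐢 = 𝐜`, and otherwise the weak order with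
all strict preferences reversed. -/
noncomputable def pneg {A : Type*} : Pbar A → Pbar A
  | none => some (indiff A)
  | some r => if r = indiff A then none else some r.reverse

/-- The inclusion `P^N ⊆ P̄^N` of profiles of weak orders. -/
def coeP {A : Type*} {N : ℕ} (p : Fin N → WeakOrder A) : Fin N → Pbar A :=
  fun j => some (p j)

/-- `w` has a dictator at individual `i`. -/
def HasDictatorAt {A : Type*} {N : ℕ} (w : (Fin N → Pbar A) → Pbar A) (i : Fin N) : Prop :=
  ∀ p : Fin N → WeakOrder A,
    (w (coeP p) = none → p i = indiff A) ∧
    (p i ≠ indiff A → barLE (w (coeP p)) (some (p i)))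

/-- The application function `Ω_i`. -/
noncomputable def Omega {A : Type*} {N : ℕ} (i : Fin N) (p : Fin N → Pbar A) (r : Pbar A) :
    Fin N → Pbar A :=
  fun j => if j = i then pinf (p i) r else none

/-- The `i`-th indicator `Υ_i`: `𝐢` in coordinate `i` and `𝐜` elsewhere. -/
def indicator {A : Type*} {N : ℕ} (i : Fin N) : Fin N → Pbar A :=
  fun j => if j = i then some (indiff A) else none

/-- Coordinatewise negation on tuples. -/
noncomputable def negT {A : Type*} {N : ℕ} (p : Fin N → Pbar A) : Fin N → Pbar A :=
  fun j => pneg (p j)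

/-- Coordinatewise extended strictness order on tuples. -/
def leT {A : Type*} {N : ℕ} (s t : Fin N → Pbar A) : Prop :=
  ∀ j, barLE (s j) (t j)

/-- `p ∗ q := Ω_i(p, w(q))` in the Self-Reference System `(w, Ω_i)`. -/
noncomputable def starOmega {A : Type*} {N : ℕ} (w : (Fin N → Pbar A) → Pbar A) (i : Fin N)
    (p q : Fin N → Pbar A) : Fin N → Pbar A :=
  Omega i p (w q)

/-- Two tuples are consistent (`s ⋈ t`) iff `s_j ⊓ t_j ≠ 𝐜` in every coordinate. -/
def Consistent {A : Type*} {N : ℕ} (s t : Fin N → Pbar A) : Prop :=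
  ∀ j, pinf (s j) (t j) ≠ none

/-- `(Υ, d)` satisfies quasi-consistency in `(w, Ω_i)`: `d ≤ ¬(Υ ∗ ¬d)`. -/
noncomputable def QuasiConsistent {A : Type*} {N : ℕ} (w : (Fin N → Pbar A) → Pbar A)
    (i : Fin N) (Υ d : Fin N → Pbar A) : Prop :=
  leT d (negT (starOmega w i Υ (negT d)))

/-- `d` is a quasi-Gödel sentence w.r.t. `Υ` in `(w, Ω_i)`: `d ≤ ¬(Υ ∗ d)`. -/
noncomputable def QuasiGodelSentence {A : Type*} {N : ℕ} (w : (Fin N → Pbar A) → Pbar A)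
    (i : Fin N) (Υ d : Fin N → Pbar A) : Prop :=
  leT d (negT (starOmega w i Υ d))

/-- `(Υ, d)` satisfies quasi-completeness in `(w, Ω_i)`:
`¬(Υ ∗ d)` and `¬(Υ ∗ ¬d)` are inconsistent. -/
noncomputable def QuasiComplete {A : Type*} {N : ℕ} (w : (Fin N → Pbar A) → Pbar A)
    (i : Fin N) (Υ d : Fin N → Pbar A) : Prop :=
  ¬ Consistent (negT (starOmega w i Υ d)) (negT (starOmega w i Υ (negT d)))

/-- `(w, Ω_i)` is a quasi-Gödelian system with respect to `Υ`. -/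
noncomputable def QuasiGodelian {A : Type*} {N : ℕ} (w : (Fin N → Pbar A) → Pbar A)
    (i : Fin N) (Υ : Fin N → Pbar A) : Prop :=
  ∃ d : Fin N → WeakOrder A,
    QuasiGodelSentence w i Υ (coeP d) ∧
    ¬ (QuasiConsistent w i Υ (coeP d) ∧ QuasiComplete w i Υ (coeP d))

/-- `a ≺ b` in `x ∈ P̄` (`𝐜` is regarded as containing every strict preference). -/
def strictIn {A : Type*} (x : Pbar A) (a b : A) : Prop :=
  match x with
  | none => True
  | some r => r.strict a b

/-- Unanimity for an extended Social Welfare Function. -/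
def Unanimity {A : Type*} {N : ℕ} (w : (Fin N → Pbar A) → Pbar A) : Prop :=
  ∀ (p : Fin N → WeakOrder A) (a b : A),
    (∀ j, (p j).strict a b) → strictIn (w (coeP p)) a b

/-- Independence of Irrelevant Alternatives for an extended Social Welfare Function. -/
def IIA {A : Type*} {N : ℕ} (w : (Fin N → Pbar A) → Pbar A) : Prop :=
  ∀ (p q : Fin N → WeakOrder A) (a b : A),
    (∀ j, ((p j).strict a b ↔ (q j).strict a b) ∧ ((p j).strict b a ↔ (q j).strict b a)) →
    ((strictIn (w (coeP p)) a b ↔ strictIn (w (coeP q)) a b) ∧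
     (strictIn (w (coeP p)) b a ↔ strictIn (w (coeP q)) b a))

theorem barLE_refl {A : Type*} (x : Pbar A) : barLE x x := by
  cases x with
  | none => trivial
  | some r => exact fun _ _ h => h

theorem barLE_indiff {A : Type*} (x : Pbar A) : barLE x (some (indiff A)) := by
  cases x with
  | none => trivial
  | some r => exact fun _ _ h => (h.2 trivial).elim

theorem eq_none_of_barLE_none {A : Type*} {x : Pbar A} (h : barLE x none) : x = none := by
  cases x with
  | none => rfl
  | some r => exact h.elim

theorem pinf_none_right {A : Type*} (x : Pbar A) : pinf x none = none := by
  unfold pinf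
  split_ifs with h
  · exact eq_none_of_barLE_none h.choose_spec.2.1
  · rfl

theorem barLE_pinf_indiff_left {A : Type*} (x : Pbar A) :
    barLE x (pinf (some (indiff A)) x) := by
  have h : ∃ t, IsGLBbar (some (indiff A)) x t :=
    ⟨x, barLE_indiff x, barLE_refl x, fun _ _ hu => hu⟩
  rw [pinf, dif_pos h]
  exact h.choose_spec.2.2 x (barLE_indiff x) (barLE_refl x)

theorem pinf_indiff_left_ne_none {A : Type*} {x : Pbar A} (hx : x ≠ none) :
    pinf (some (indiff A)) x ≠ none := fun h =>
  hx (eq_none_of_barLE_none (h ▸ barLE_pinf_indiff_left x))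

theorem negT_starOmega_of_eq_none {A : Type*} {N : ℕ} {w : (Fin N → Pbar A) → Pbar A}
    {d : Fin N → Pbar A} (hd : w d = none) (i : Fin N) (p : Fin N → Pbar A) :
    negT (starOmega w i p d) = fun _ => some (indiff A) := by
  funext j
  simp only [negT, starOmega, Omega, hd, pinf_none_right, ite_self, pneg]

theorem quasiGodelSentence_of_eq_none {A : Type*} {N : ℕ} {w : (Fin N → Pbar A) → Pbar A}
    {d : Fin N → Pbar A} (hd : w d = none) (i : Fin N) (p : Fin N → Pbar A) :
    QuasiGodelSentence w i p d := fun j => by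
  rw [negT_starOmega_of_eq_none hd]
  exact barLE_indiff _

theorem not_quasiConsistent_and_quasiComplete {A : Type*} {N : ℕ}
    {w : (Fin N → Pbar A) → Pbar A} {q : Fin N → WeakOrder A} (hq : w (coeP q) = none)
    (i : Fin N) (p : Fin N → Pbar A) :
    ¬ (QuasiConsistent w i p (coeP q) ∧ QuasiComplete w i p (coeP q)) := by
  rintro ⟨hcons, hcompl⟩
  refine hcompl fun j => ?_
  rw [negT_starOmega_of_eq_none hq]
  refine pinf_indiff_left_ne_none fun h => ?_
  have hj := hcons j
  rw [h] at hj
  exact hj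

/-- If `w` admits a profile `q ∈ P^N` with `w(q) = 𝐜`, then for
every individual `i`, in the Self-Reference System `(w, Ω_i)`: `q` is a
quasi-Gödel sentence w.r.t. the indicator `Υ_i`, quasi-consistency and
quasi-completeness of `(Υ_i, q)` cannot hold simultaneously, and hence
`(w, Ω_i)` is a quasi-Gödelian system with respect to `Υ_i`. -/
theorem condorcet_quasi_godelian {A : Type*} {N : ℕ}
    (w : (Fin N → Pbar A) → Pbar A)
    (q : Fin N → WeakOrder A) (hq : w (coeP q) = none) :
    ∀ i : Fin N,
      QuasiGodelSentence w i (indicator i) (coeP q) ∧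
      ¬ (QuasiConsistent w i (indicator i) (coeP q) ∧
          QuasiComplete w i (indicator i) (coeP q)) ∧
      QuasiGodelian w i (indicator i) := by
  exact fun i =>
    ⟨quasiGodelSentence_of_eq_none hq i _, not_quasiConsistent_and_quasiComplete hq i _,
      q, quasiGodelSentence_of_eq_none hq i _, not_quasiConsistent_and_quasiComplete hq i _⟩
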